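/- Let p > 1, β > 0, and μ₁, μ₂ ∈ ℝ with μ₁ + β ≤ 0 and μ₂ + β ≤ 0, and let c₁, c₂ > 0. Then there exists M > 0 such that I(u,v) ≥ −M for every pair (u,v) admissible for (c₁,c₂). -/

import Mathlib

open MeasureTheory

noncomputable section

abbrev Plane := EuclideanSpace ℝ (Fin 2)

/-- A pair `(u,v)` is admissible for masses `(c₁,c₂)`: `C¹`, in `L² ∩ L^{2p}` with the
prescribed `L²` masses, finite Dirichlet energy, finite `log(1+|x|)`-weighted `L²` norm,
and integrable logarithmic interaction kernel.  (In Lean, `Real.log 0 = 0`, so the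
integrand `log ‖x−y‖ ⋯` is interpreted as `0` on the diagonal.) -/
def Admissible (p c₁ c₂ : ℝ) (u v : Plane → ℝ) : Prop :=
  ContDiff ℝ 1 u ∧ ContDiff ℝ 1 v ∧
  Integrable (fun x => (u x) ^ 2) ∧ Integrable (fun x => (v x) ^ 2) ∧
  Integrable (fun x => |u x| ^ (2 * p)) ∧ Integrable (fun x => |v x| ^ (2 * p)) ∧
  (∫ x, (u x) ^ 2) = c₁ ∧ (∫ x, (v x) ^ 2) = c₂ ∧
  Integrable (fun x => ‖gradient u x‖ ^ 2 + ‖gradient v x‖ ^ 2) ∧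
  Integrable (fun x => Real.log (1 + ‖x‖) * ((u x) ^ 2 + (v x) ^ 2)) ∧
  Integrable (fun z : Plane × Plane =>
    Real.log ‖z.1 - z.2‖ * ((u z.1) ^ 2 + (v z.1) ^ 2) * ((u z.2) ^ 2 + (v z.2) ^ 2))

/-- The energy functional `I(u,v)`. -/
def energy (p μ₁ μ₂ β : ℝ) (u v : Plane → ℝ) : ℝ :=
  (1 / 2) * (∫ x, ‖gradient u x‖ ^ 2 + ‖gradient v x‖ ^ 2) +
  (1 / 4) * (∫ z : Plane × Plane,
    Real.log ‖z.1 - z.2‖ * ((u z.1) ^ 2 + (v z.1) ^ 2) * ((u z.2) ^ 2 + (v z.2) ^ 2)) -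
  (1 / (2 * p)) * (μ₁ * (∫ x, |u x| ^ (2 * p)) + μ₂ * (∫ x, |v x| ^ (2 * p)) +
    2 * β * (∫ x, |u x * v x| ^ p))

/-- The unit vector of angle `θ` in the plane. -/
def unitVector (θ : ℝ) : Plane := !₂[Real.cos θ, Real.sin θ]

lemma norm_unitVector (θ : ℝ) : ‖unitVector θ‖ = 1 := by
  simp [unitVector, EuclideanSpace.norm_eq]

lemma continuous_unitVector : Continuous unitVector := by
  unfold unitVector
  fun_prop

/-- Integration over the Euclidean plane in polar coordinates. -/
lemma integral_plane_eq_integral_polar (F : Plane → ℝ) :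
    ∫ z, F z = ∫ q in polarCoord.target, q.1 * F (q.1 • unitVector q.2) := by
  have h₁ : ∫ a : Fin 2 → ℝ, F (WithLp.toLp 2 a) = ∫ z, F z :=
    (EuclideanSpace.volume_preserving_symm_measurableEquiv_toLp (Fin 2)).symm.integral_comp'
      (g := F)
  have h₂ : ∫ q : ℝ × ℝ, F (WithLp.toLp 2 ((MeasurableEquiv.finTwoArrow (α := ℝ)).symm q)) =
      ∫ a : Fin 2 → ℝ, F (WithLp.toLp 2 a) :=
    (volume_preserving_finTwoArrow ℝ).symm.integral_comp' (g := fun a => F (WithLp.toLp 2 a))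
  rw [← h₁, ← h₂, ← integral_comp_polarCoord_symm]
  refine setIntegral_congr_fun polarCoord.open_target.measurableSet fun q _ => ?_
  simp only [smul_eq_mul]
  congr 2
  ext i
  fin_cases i <;> simp [unitVector, polarCoord]

/-- Integration over the unit disc in polar coordinates. -/
lemma setIntegral_ball_eq_integral_polar (F : Plane → ℝ) :
    ∫ z in Metric.ball 0 1, F z =
      ∫ q in Set.Ioo (0 : ℝ) 1 ×ˢ Set.Ioo (-Real.pi) Real.pi,
        q.1 * F (q.1 • unitVector q.2) := by
  rw [← integral_indicator measurableSet_ball, integral_plane_eq_integral_polar,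
    ← integral_indicator polarCoord.open_target.measurableSet,
    ← integral_indicator (measurableSet_Ioo.prod measurableSet_Ioo)]
  congr 1
  ext ⟨r, θ⟩
  have hn : ‖r • unitVector θ‖ = |r| := by rw [norm_smul, norm_unitVector]; simp
  by_cases hr : 0 < r
  · by_cases hr1 : r < 1 <;> by_cases hθ : θ ∈ Set.Ioo (-Real.pi) Real.pi <;>
      simp [Set.indicator, polarCoord, hn, hr, hr1, abs_of_pos hr]
  · simp [Set.indicator, polarCoord, hr]

lemma integrableOn_inv_norm_ball :
    IntegrableOn (fun z : Plane => ‖z‖⁻¹) (Metric.ball 0 1) := by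
  refine Integrable.of_integral_ne_zero ?_
  rw [setIntegral_ball_eq_integral_polar]
  have : ∫ q in Set.Ioo (0 : ℝ) 1 ×ˢ Set.Ioo (-Real.pi) Real.pi,
      q.1 * ‖q.1 • unitVector q.2‖⁻¹ =
      ∫ q in Set.Ioo (0 : ℝ) 1 ×ˢ Set.Ioo (-Real.pi) Real.pi, (1 : ℝ) := by
    refine setIntegral_congr_fun (measurableSet_Ioo.prod measurableSet_Ioo) fun q hq => ?_
    have hq0 : 0 < q.1 := hq.1.1
    simp only [norm_smul, norm_unitVector, Real.norm_eq_abs, abs_of_pos hq0, mul_one]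
    exact mul_inv_cancel₀ hq0.ne'
  rw [this]
  simp only [integral_const, smul_eq_mul, mul_one, MeasurableSet.univ, measureReal_restrict_apply,
    Set.univ_inter]
  rw [Measure.volume_eq_prod, measureReal_prod_prod]
  simp [Real.pi_pos.le, Real.pi_ne_zero, measureReal_def]

lemma integrableOn_inv_norm_mul_ball {h : Plane → ℝ} (hh : Continuous h) :
    IntegrableOn (fun z : Plane => ‖z‖⁻¹ * h z) (Metric.ball 0 1) := by
  obtain ⟨C, hC⟩ := (isCompact_closedBall (0 : Plane) 1).exists_bound_of_continuousOn
    hh.continuousOn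
  refine Integrable.mul_bdd (c := C) integrableOn_inv_norm_ball
    hh.aestronglyMeasurable ?_
  filter_upwards [ae_restrict_mem measurableSet_ball] with z hz
  exact hC z (Metric.ball_subset_closedBall hz)

lemma integrableOn_ball_of_continuous {h : Plane → ℝ} (hh : Continuous h) :
    IntegrableOn h (Metric.ball 0 1) :=
  (hh.continuousOn.integrableOn_compact (isCompact_closedBall (0 : Plane) 1)).mono_set
    Metric.ball_subset_closedBall

/-- A local Hardy inequality along a ray. -/
lemma integral_ray_le_zero {h G : Plane → ℝ} (hh : ContDiff ℝ 1 h) (hG : Continuous G)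
    (hG0 : ∀ z, 0 ≤ G z) (hhG : ∀ z, ‖fderiv ℝ h z‖ ≤ G z) {e : Plane} (he : ‖e‖ = 1) :
    ∫ r in (0 : ℝ)..1, ((1 - 2 * r) * h (r • e) - r * G (r • e)) ≤ 0 := by
  have hcont : Continuous fun r : ℝ => fderiv ℝ h (r • e) e :=
    ((hh.continuous_fderiv one_ne_zero).comp (by fun_prop)).clm_apply continuous_const
  have hc := hh.continuous
  have hderiv : ∀ r : ℝ, HasDerivAt (fun r : ℝ => (r - r ^ 2) * h (r • e))
      ((1 - 2 * r) * h (r • e) + (r - r ^ 2) * fderiv ℝ h (r • e) e) r := by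
    intro r
    have h₁ : HasDerivAt (fun r : ℝ => r • e) e r := by
      simpa using (hasDerivAt_id r).smul_const e
    have h₂ : HasDerivAt (fun r : ℝ => h (r • e)) (fderiv ℝ h (r • e) e) r :=
      ((hh.differentiable one_ne_zero) (r • e)).hasFDerivAt.comp_hasDerivAt r h₁
    have h₃ : HasDerivAt (fun r : ℝ => r - r ^ 2) (1 - 2 * r) r := by
      simpa using (hasDerivAt_id' r).fun_sub (hasDerivAt_pow 2 r)
    exact h₃.mul h₂
  calc
    _ ≤ ∫ r in (0 : ℝ)..1,
        ((1 - 2 * r) * h (r • e) + (r - r ^ 2) * fderiv ℝ h (r • e) e) := by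
      refine intervalIntegral.integral_mono_on zero_le_one
        (Continuous.intervalIntegrable (by fun_prop) _ _)
        (Continuous.intervalIntegrable (by fun_prop) _ _) fun r hr => ?_
      have h₁ : |fderiv ℝ h (r • e) e| ≤ G (r • e) := by
        have := (fderiv ℝ h (r • e)).le_opNorm e
        rw [he, mul_one, Real.norm_eq_abs] at this
        exact this.trans (hhG _)
      have h₂ := (abs_le.mp h₁).1
      have h₃ : 0 ≤ r - r ^ 2 := by nlinarith [hr.1, hr.2]
      nlinarith [mul_le_mul_of_nonneg_left h₂ h₃, mul_nonneg (sq_nonneg r) (hG0 (r • e))]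
    _ = 0 := by
      rw [intervalIntegral.integral_eq_sub_of_hasDerivAt (fun r _ => hderiv r)
        (Continuous.intervalIntegrable (by fun_prop) _ _)]
      simp

/-- A local Hardy inequality on the unit disc. -/
lemma setIntegral_ball_inv_norm_le {h G : Plane → ℝ} (hh : ContDiff ℝ 1 h) (hG : Continuous G)
    (hG0 : ∀ z, 0 ≤ G z) (hhG : ∀ z, ‖fderiv ℝ h z‖ ≤ G z) :
    ∫ z in Metric.ball 0 1, (‖z‖⁻¹ * h z - 2 * h z) ≤ ∫ z in Metric.ball 0 1, G z := by
  have hc := hh.continuous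
  have hu := continuous_unitVector
  have hI : IntegrableOn (fun z => ‖z‖⁻¹ * h z - 2 * h z) (Metric.ball 0 1) :=
    (integrableOn_inv_norm_mul_ball hc).sub (integrableOn_ball_of_continuous (by fun_prop))
  rw [← sub_nonpos, ← integral_sub hI (integrableOn_ball_of_continuous hG),
    setIntegral_ball_eq_integral_polar]
  have hcongr : ∫ q in Set.Ioo (0 : ℝ) 1 ×ˢ Set.Ioo (-Real.pi) Real.pi,
      q.1 * (‖q.1 • unitVector q.2‖⁻¹ * h (q.1 • unitVector q.2) - 2 * h (q.1 • unitVector q.2)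
        - G (q.1 • unitVector q.2)) =
      ∫ q in Set.Ioo (0 : ℝ) 1 ×ˢ Set.Ioo (-Real.pi) Real.pi,
        ((1 - 2 * q.1) * h (q.1 • unitVector q.2) - q.1 * G (q.1 • unitVector q.2)) := by
    refine setIntegral_congr_fun (measurableSet_Ioo.prod measurableSet_Ioo) fun q hq => ?_
    have hq0 : 0 < q.1 := hq.1.1
    simp only [norm_smul, norm_unitVector, Real.norm_eq_abs, abs_of_pos hq0, mul_one]
    field_simp
  rw [hcongr]
  have hint : IntegrableOn (fun q : ℝ × ℝ =>
      (1 - 2 * q.1) * h (q.1 • unitVector q.2) - q.1 * G (q.1 • unitVector q.2))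
      (Set.Ioo (0 : ℝ) 1 ×ˢ Set.Ioo (-Real.pi) Real.pi) := by
    refine IntegrableOn.mono_set (t := Set.Icc (0 : ℝ) 1 ×ˢ Set.Icc (-Real.pi) Real.pi) ?_
      (Set.prod_mono Set.Ioo_subset_Icc_self Set.Ioo_subset_Icc_self)
    exact ContinuousOn.integrableOn_compact (isCompact_Icc.prod isCompact_Icc)
      (Continuous.continuousOn (by fun_prop))
  rw [IntegrableOn, Measure.volume_eq_prod, ← Measure.prod_restrict] at hint
  rw [Measure.volume_eq_prod, ← Measure.prod_restrict, integral_prod_symm _ hint]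
  refine integral_nonpos fun θ => ?_
  have := integral_ray_le_zero hh hG hG0 hhG (norm_unitVector θ)
  rwa [intervalIntegral.integral_of_le zero_le_one, integral_Ioc_eq_integral_Ioo] at this

/-- Lower bound for the logarithmic potential of a nonnegative `C¹` density. -/
lemma neg_le_integral_log_mul {ρ G : Plane → ℝ} (hρ : ContDiff ℝ 1 ρ) (hρ0 : ∀ z, 0 ≤ ρ z)
    (hρi : Integrable ρ) (hG : Continuous G) (hG0 : ∀ z, 0 ≤ G z) (hGi : Integrable G)
    (hρG : ∀ z, ‖fderiv ℝ ρ z‖ ≤ G z) (x : Plane) :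
    -((∫ y, ρ y) + ∫ y, G y) ≤ ∫ y, Real.log ‖x - y‖ * ρ y := by
  have hρt : ContDiff ℝ 1 fun z => ρ (x + z) := hρ.comp (contDiff_const.add contDiff_id)
  have hρc := hρ.continuous
  rw [← integral_add_left_eq_self (fun y => Real.log ‖x - y‖ * ρ y) x,
    ← integral_add_left_eq_self ρ x, ← integral_add_left_eq_self G x]
  by_cases hlog : Integrable fun z => Real.log ‖x - (x + z)‖ * ρ (x + z)
  swap
  · rw [integral_undef hlog]
    have h₁ : 0 ≤ ∫ z, ρ (x + z) := integral_nonneg fun z => hρ0 _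
    have h₂ : 0 ≤ ∫ z, G (x + z) := integral_nonneg fun z => hG0 _
    linarith
  have hρi' : Integrable fun z => ρ (x + z) := hρi.comp_add_left x
  have hGi' : Integrable fun z => G (x + z) := hGi.comp_add_left x
  have hH : IntegrableOn (fun z => ‖z‖⁻¹ * ρ (x + z) - 2 * ρ (x + z)) (Metric.ball 0 1) :=
    (integrableOn_inv_norm_mul_ball (h := fun z => ρ (x + z)) (by fun_prop)).sub
      (integrableOn_ball_of_continuous (by fun_prop))
  have hhardy := setIntegral_ball_inv_norm_le hρt (G := fun z => G (x + z)) (by fun_prop)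
    (fun z => hG0 _) (fun z => by rw [fderiv_comp_add_left]; exact hρG _)
  have hball : ∫ z in Metric.ball 0 1, G (x + z) ≤ ∫ z, G (x + z) :=
    setIntegral_le_integral hGi' (ae_of_all _ fun z => hG0 _)
  have hmono : ∫ z, -(Real.log ‖x - (x + z)‖ * ρ (x + z)) ≤
      ∫ z, (ρ (x + z) + (Metric.ball 0 1).indicator
        (fun z => ‖z‖⁻¹ * ρ (x + z) - 2 * ρ (x + z)) z) := by
    refine integral_mono_ae hlog.neg (hρi'.add (hH.integrable_indicator measurableSet_ball)) ?_
    filter_upwards [compl_mem_ae_iff.mpr (measure_singleton (0 : Plane))] with z hz0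
    have hz : ‖x - (x + z)‖ = ‖z‖ := by simp
    have hr := hρ0 (x + z)
    simp only [hz]
    by_cases hz1 : ‖z‖ < 1
    · rw [Set.indicator_of_mem (by simpa using hz1)]
      have hl : -Real.log ‖z‖ ≤ ‖z‖⁻¹ - 1 := by
        rw [← Real.log_inv]
        exact Real.log_le_sub_one_of_pos (inv_pos.mpr (norm_pos_iff.mpr hz0))
      nlinarith [mul_le_mul_of_nonneg_right hl hr]
    · rw [Set.indicator_of_notMem (by simpa using hz1)]
      nlinarith [mul_nonneg (Real.log_nonneg (not_lt.mp hz1)) hr]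
  rw [integral_neg, integral_add hρi' (hH.integrable_indicator measurableSet_ball),
    integral_indicator measurableSet_ball] at hmono
  linarith

/-- Lower bound for the logarithmic interaction energy of a nonnegative `C¹` density. -/
lemma neg_le_integral_log_interaction {ρ G : Plane → ℝ} (hρ : ContDiff ℝ 1 ρ)
    (hρ0 : ∀ z, 0 ≤ ρ z) (hρi : Integrable ρ) (hG : Continuous G) (hG0 : ∀ z, 0 ≤ G z)
    (hGi : Integrable G) (hρG : ∀ z, ‖fderiv ℝ ρ z‖ ≤ G z)
    (hlog : Integrable fun z : Plane × Plane => Real.log ‖z.1 - z.2‖ * ρ z.1 * ρ z.2) :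
    -((∫ y, ρ y) * ((∫ y, ρ y) + ∫ y, G y)) ≤
      ∫ z : Plane × Plane, Real.log ‖z.1 - z.2‖ * ρ z.1 * ρ z.2 := by
  rw [Measure.volume_eq_prod] at hlog ⊢
  rw [integral_prod _ hlog, ← mul_neg, ← integral_mul_const]
  refine integral_mono (hρi.mul_const _) hlog.integral_prod_left fun x => ?_
  have h₁ : ∀ y, Real.log ‖x - y‖ * ρ x * ρ y = ρ x * (Real.log ‖x - y‖ * ρ y) :=
    fun y => by ring
  simp only [h₁, integral_const_mul]
  exact mul_le_mul_of_nonneg_left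
    (neg_le_integral_log_mul hρ hρ0 hρi hG hG0 hGi hρG x) (hρ0 x)

lemma norm_fderiv_eq_norm_gradient (u : Plane → ℝ) (z : Plane) :
    ‖fderiv ℝ u z‖ = ‖gradient u z‖ := by
  simp [gradient]

lemma norm_fderiv_sq_add_sq_le {u v : Plane → ℝ} (hu : ContDiff ℝ 1 u) (hv : ContDiff ℝ 1 v)
    {ε : ℝ} (hε : 0 < ε) (z : Plane) :
    ‖fderiv ℝ (fun x => u x ^ 2 + v x ^ 2) z‖ ≤
      ε * (‖gradient u z‖ ^ 2 + ‖gradient v z‖ ^ 2) + ε⁻¹ * (u z ^ 2 + v z ^ 2) := by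
  have hu' := (hu.differentiable one_ne_zero z).hasFDerivAt
  have hv' := (hv.differentiable one_ne_zero z).hasFDerivAt
  have hd := ((hu'.pow 2).add (hv'.pow 2)).fderiv
  have young : ∀ a b : ℝ, 2 * |a| * b ≤ ε * b ^ 2 + ε⁻¹ * a ^ 2 := by
    intro a b
    have : ε * b ^ 2 + ε⁻¹ * a ^ 2 - 2 * |a| * b = ε⁻¹ * (ε * b - |a|) ^ 2 := by
      rw [← sq_abs a]
      field_simp
      ring
    have h₀ : 0 ≤ ε⁻¹ * (ε * b - |a|) ^ 2 := by positivity
    linarith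
  calc
    _ ≤ 2 * |u z| * ‖gradient u z‖ + 2 * |v z| * ‖gradient v z‖ := by
      rw [← norm_fderiv_eq_norm_gradient, ← norm_fderiv_eq_norm_gradient]
      refine (congrArg norm hd).trans_le ((norm_add_le _ _).trans_eq ?_)
      simp [norm_smul]
    _ ≤ _ := by linarith [young (u z) ‖gradient u z‖, young (v z) ‖gradient v z‖]

lemma continuous_norm_gradient {u : Plane → ℝ} (hu : ContDiff ℝ 1 u) :
    Continuous fun z => ‖gradient u z‖ := by
  simp only [← norm_fderiv_eq_norm_gradient]
  exact (hu.continuous_fderiv one_ne_zero).norm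

/-- Under the sign conditions the power nonlinearity contributes nonnegatively to the energy. -/
lemma power_terms_nonpos {p β μ₁ μ₂ : ℝ} (hβ : 0 < β) (hμ₁ : μ₁ + β ≤ 0) (hμ₂ : μ₂ + β ≤ 0)
    {u v : Plane → ℝ} (hu : Integrable fun x => |u x| ^ (2 * p))
    (hv : Integrable fun x => |v x| ^ (2 * p)) :
    μ₁ * (∫ x, |u x| ^ (2 * p)) + μ₂ * (∫ x, |v x| ^ (2 * p)) +
      2 * β * (∫ x, |u x * v x| ^ p) ≤ 0 := by
  have hsq : ∀ a : ℝ, |a| ^ (2 * p) = (|a| ^ p) ^ 2 := fun a => by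
    rw [mul_comm, Real.rpow_mul (abs_nonneg a), Real.rpow_two]
  have hmono : ∫ x, 2 * |u x * v x| ^ p ≤ ∫ x, (|u x| ^ (2 * p) + |v x| ^ (2 * p)) := by
    refine integral_mono_of_nonneg (ae_of_all _ fun x => by positivity) (hu.add hv)
      (ae_of_all _ fun x => ?_)
    simp only [hsq, abs_mul, Real.mul_rpow (abs_nonneg _) (abs_nonneg _)]
    linarith [two_mul_le_add_sq (|u x| ^ p) (|v x| ^ p)]
  rw [integral_const_mul, integral_add hu hv] at hmono
  have hU : 0 ≤ ∫ x, |u x| ^ (2 * p) := integral_nonneg fun x => by positivity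
  have hV : 0 ≤ ∫ x, |v x| ^ (2 * p) := integral_nonneg fun x => by positivity
  nlinarith [mul_le_mul_of_nonneg_left hmono hβ.le, mul_nonneg (neg_nonneg.mpr hμ₁) hU,
    mul_nonneg (neg_nonneg.mpr hμ₂) hV]

/-- If `β > 0` and `μ₁ + β ≤ 0`, `μ₂ + β ≤ 0`, the energy is bounded from below on the
constraint set. -/
theorem stmt11 (p β μ₁ μ₂ c₁ c₂ : ℝ) (hp : 1 < p) (hβ : 0 < β)
    (hμ₁ : μ₁ + β ≤ 0) (hμ₂ : μ₂ + β ≤ 0) (hc₁ : 0 < c₁) (hc₂ : 0 < c₂) :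
    ∃ M : ℝ, 0 < M ∧ ∀ u v : Plane → ℝ, Admissible p c₁ c₂ u v →
      -M ≤ energy p μ₁ μ₂ β u v := by
  set c := c₁ + c₂ with hc
  have hc0 : 0 < c := by positivity
  refine ⟨c ^ 2 / 4 + c ^ 3 / 8, by positivity, fun u v hadm => ?_⟩
  obtain ⟨hu, hv, hu2, hv2, hup, hvp, hcu, hcv, hgrad, -, hlog⟩ := hadm
  have hε : 0 < 2 / c := by positivity
  have hgu := continuous_norm_gradient hu
  have hgv := continuous_norm_gradient hv
  have huc := hu.continuous
  have hvc := hv.continuous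
  have hmass : ∫ x, (u x ^ 2 + v x ^ 2) = c := by rw [integral_add hu2 hv2, hcu, hcv]
  have hmassi : Integrable fun x => u x ^ 2 + v x ^ 2 := hu2.add hv2
  have hGint : ∫ x, (2 / c * (‖gradient u x‖ ^ 2 + ‖gradient v x‖ ^ 2) +
      (2 / c)⁻¹ * (u x ^ 2 + v x ^ 2)) =
      2 / c * (∫ x, (‖gradient u x‖ ^ 2 + ‖gradient v x‖ ^ 2)) + (2 / c)⁻¹ * c := by
    rw [integral_add (hgrad.const_mul _) (hmassi.const_mul _), integral_const_mul,
      integral_const_mul, hmass]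
  have hinter := neg_le_integral_log_interaction (ρ := fun x => u x ^ 2 + v x ^ 2)
    (G := fun x => 2 / c * (‖gradient u x‖ ^ 2 + ‖gradient v x‖ ^ 2) +
      (2 / c)⁻¹ * (u x ^ 2 + v x ^ 2))
    ((hu.pow 2).add (hv.pow 2)) (fun z => by positivity) hmassi (by fun_prop)
    (fun z => by positivity) ((hgrad.const_mul _).add (hmassi.const_mul _))
    (norm_fderiv_sq_add_sq_le hu hv hε) hlog
  rw [hGint, hmass] at hinter
  have hpow : 0 ≤ -(1 / (2 * p) * (μ₁ * (∫ x, |u x| ^ (2 * p)) + μ₂ * (∫ x, |v x| ^ (2 * p)) +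
      2 * β * (∫ x, |u x * v x| ^ p))) :=
    neg_nonneg.mpr (mul_nonpos_of_nonneg_of_nonpos (by positivity)
      (power_terms_nonpos hβ hμ₁ hμ₂ hup hvp))
  have hsplit : ∀ D : ℝ, c * (c + (2 / c * D + (2 / c)⁻¹ * c)) = c ^ 2 + 2 * D + c ^ 3 / 2 := by
    intro D
    field_simp
    ring
  rw [hsplit] at hinter
  unfold energy
  linarith
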